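/- Let d ≥ 1, θ ∈ (0,1), μ, λ ∈ ℝ, and let 0 < a < b with a < b/2^d. Let p : (0,∞) → ℝ be continuously differentiable and satisfy p(a/t^d) = p(b/t^d) for all t ∈ [1,2]. Define u : (1,2) × ℝ^d → ℝ^d by u(t,y) = y/t, and define ρ : (1,2) × ℝ^d → ℝ by ρ(t,y) = a/t^d if k·t < |y| < (k+θ)·t for some k ∈ ℕ₀, and ρ(t,y) = b/t^d if (k+θ)·t < |y| < (k+1)·t for some k ∈ ℕ₀ (ρ is defined almost everywhere, the interfaces having measure zero). Then (ρ, u) is a weak solution of the compressible Navier–Stokes system on (1,2) × ℝ^d: for every φ ∈ C_c^∞((1,2) × ℝ^d; ℝ), ∫∫ ( ρ ∂_t φ + Σ_j ρ u_j ∂_{y_j} φ ) dt dy = 0, and for every ψ ∈ C_c^∞((1,2) × ℝ^d; ℝ^d), ∫∫ ( Σ_i ρ u_i ∂_t ψ_i + Σ_{i,j} ρ u_i u_j ∂_{y_j} ψ_i + p(ρ)·Σ_i ∂_{y_i} ψ_i − μ·Σ_{i,j} (∂_{y_j} u_i + ∂_{y_i} u_j) ∂_{y_j} ψ_i − λ·(Σ_k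 ∂_{y_k} u_k)·(Σ_i ∂_{y_i} ψ_i) ) dt dy = 0. -/

import Mathlib

open MeasureTheory

/-- The open time strip. -/
abbrev nsStrip (d : ℕ) : Set (ℝ × EuclideanSpace ℝ (Fin d)) :=
  Set.Ioo (1 : ℝ) 2 ×ˢ (Set.univ : Set (EuclideanSpace ℝ (Fin d)))

lemma nsStrip_open (d : ℕ) : IsOpen (nsStrip d) := isOpen_Ioo.prod isOpen_univ

lemma nsStrip_measure (d : ℕ) :
    (volume : Measure (ℝ × EuclideanSpace ℝ (Fin d))).restrict (nsStrip d)
      = (volume.restrict (Set.Ioo (1 : ℝ) 2)).prod volume := by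
  rw [Measure.volume_eq_prod, ← Measure.prod_restrict, Measure.restrict_univ]

lemma ns_integrable {d : ℕ} {K : Set (ℝ × EuclideanSpace ℝ (Fin d))} (hK : IsCompact K)
    (hKs : K ⊆ nsStrip d) {f : ℝ × EuclideanSpace ℝ (Fin d) → ℝ}
    (hf : ContinuousOn f (nsStrip d)) (h0 : ∀ p, p ∉ K → f p = 0) :
    Integrable f (volume.restrict (nsStrip d)) := by
  have hsub : tsupport f ⊆ K := by
    refine closure_minimal (fun p hp => ?_) hK.isClosed
    by_contra h
    exact hp (h0 p h)
  have hc : Continuous f := continuous_of_tsupport fun p hp =>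
    hf.continuousAt ((nsStrip_open d).mem_nhds (hKs (hsub hp)))
  exact (hc.integrable_of_hasCompactSupport (HasCompactSupport.intro hK h0)).restrict

lemma ns_fderiv_zero {d : ℕ} {φ : ℝ × EuclideanSpace ℝ (Fin d) → ℝ}
    {p : ℝ × EuclideanSpace ℝ (Fin d)} (hp : p ∉ tsupport φ) : fderiv ℝ φ p = 0 := by
  by_contra h
  exact hp (tsupport_fderiv_subset ℝ (subset_tsupport _ h))

/-- Transport part. -/
lemma ns_transport {d : ℕ} (c w : EuclideanSpace ℝ (Fin d) → ℝ) (hc : Measurable c) (C : ℝ)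
    (hC : ∀ x, ‖c x‖ ≤ C) (hw : Continuous w)
    (φ : ℝ × EuclideanSpace ℝ (Fin d) → ℝ) (hφ : ContDiff ℝ (⊤ : ℕ∞) φ)
    (hcs : HasCompactSupport φ) (hs : tsupport φ ⊆ nsStrip d) :
    Integrable (fun p : ℝ × EuclideanSpace ℝ (Fin d) => c (p.1⁻¹ • p.2) *
      (w (p.1⁻¹ • p.2) / p.1 ^ d * fderiv ℝ φ p (1, p.1⁻¹ • p.2)))
      (volume.restrict (nsStrip d)) ∧
    ∫ p in nsStrip d, c (p.1⁻¹ • p.2) *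
      (w (p.1⁻¹ • p.2) / p.1 ^ d * fderiv ℝ φ p (1, p.1⁻¹ • p.2)) = 0 := by
  have hdφ : Continuous (fderiv ℝ φ) := hφ.continuous_fderiv (by simp)
  have hint : Integrable (fun p : ℝ × EuclideanSpace ℝ (Fin d) => c (p.1⁻¹ • p.2) *
      (w (p.1⁻¹ • p.2) / p.1 ^ d * fderiv ℝ φ p (1, p.1⁻¹ • p.2)))
      (volume.restrict (nsStrip d)) := by
    refine Integrable.bdd_mul (c := C) ?_ ?_ (Filter.Eventually.of_forall fun p => hC _)
    · refine ns_integrable hcs hs ?_ ?_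
      · have hne : ∀ p ∈ nsStrip d, p.1 ≠ 0 := fun p hp => by
          have := hp.1.1
          linarith
        have h1 : ContinuousOn (fun p : ℝ × EuclideanSpace ℝ (Fin d) => p.1⁻¹ • p.2)
            (nsStrip d) := (continuousOn_fst.inv₀ hne).smul continuousOn_snd
        refine ContinuousOn.mul (ContinuousOn.div (hw.comp_continuousOn h1)
          (continuousOn_fst.pow d) fun p hp => pow_ne_zero _ (hne p hp)) ?_
        exact hdφ.continuousOn.clm_apply (continuousOn_const.prodMk h1)
      · intro p hp
        rw [ns_fderiv_zero hp]
        simp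
    · exact (hc.comp (by fun_prop)).aestronglyMeasurable
  refine ⟨hint, ?_⟩
  rw [nsStrip_measure] at hint ⊢
  rw [integral_prod _ hint]
  have h2 : Integrable (Function.uncurry fun (t : ℝ) (x : EuclideanSpace ℝ (Fin d)) =>
      c x * (w x * fderiv ℝ φ (t, t • x) (1, x)))
      ((volume.restrict (Set.Ioo (1 : ℝ) 2)).prod volume) := by
    rw [← nsStrip_measure]
    refine Integrable.bdd_mul (f := fun p : ℝ × EuclideanSpace ℝ (Fin d) => c p.2)
      (g := fun p : ℝ × EuclideanSpace ℝ (Fin d) => w p.2 * fderiv ℝ φ (p.1, p.1 • p.2) (1, p.2)) (c := C) ?_ ?_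
        (Filter.Eventually.of_forall fun p => hC _)
    · obtain ⟨R, hR⟩ := hcs.isCompact.isBounded.subset_closedBall 0
      refine (Continuous.integrable_of_hasCompactSupport ?_ ?_).restrict
      · refine (hw.comp continuous_snd).mul ?_
        exact (hdφ.comp (by fun_prop)).clm_apply (by fun_prop)
      · refine HasCompactSupport.intro (K := Set.Icc (1 : ℝ) 2 ×ˢ Metric.closedBall 0 R)
          (isCompact_Icc.prod (isCompact_closedBall _ _)) fun p hp => ?_
        have : (p.1, p.1 • p.2) ∉ tsupport φ := by
          intro h
          apply hp
          have h1 := (hs h).1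
          simp only [Set.mem_Ioo] at h1
          refine ⟨⟨h1.1.le, h1.2.le⟩, ?_⟩
          have h3 := hR h
          rw [mem_closedBall_zero_iff] at h3 ⊢
          have h4 : ‖p.1 • p.2‖ ≤ R := (norm_snd_le (p.1, p.1 • p.2)).trans h3
          rw [norm_smul, Real.norm_eq_abs, abs_of_pos (by linarith)] at h4
          nlinarith [norm_nonneg p.2]
        rw [ns_fderiv_zero this]
        simp
    · exact (hc.comp measurable_snd).aestronglyMeasurable
  have h3 : ∀ t ∈ Set.Ioo (1 : ℝ) 2,
      (∫ y : EuclideanSpace ℝ (Fin d), c (t⁻¹ • y) *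
        (w (t⁻¹ • y) / t ^ d * fderiv ℝ φ (t, y) (1, t⁻¹ • y)))
      = ∫ x : EuclideanSpace ℝ (Fin d), c x * (w x * fderiv ℝ φ (t, t • x) (1, x)) := by
    intro t ht
    have ht0 : 0 < t := by linarith [ht.1]
    have h := Measure.integral_comp_smul (volume : Measure (EuclideanSpace ℝ (Fin d)))
      (fun y : EuclideanSpace ℝ (Fin d) => c (t⁻¹ • y) *
        (w (t⁻¹ • y) / t ^ d * fderiv ℝ φ (t, y) (1, t⁻¹ • y))) t
    rw [finrank_euclideanSpace_fin, abs_of_pos (by positivity), smul_eq_mul] at h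
    have h' := congrArg (fun z => t ^ d * z) h
    beta_reduce at h'
    rw [mul_inv_cancel_left₀ (by positivity)] at h'
    rw [← h', ← integral_const_mul]
    refine integral_congr_ae (Filter.Eventually.of_forall fun x => ?_)
    simp only [inv_smul_smul₀ ht0.ne']
    field_simp
  rw [setIntegral_congr_fun measurableSet_Ioo h3, integral_integral_swap h2]
  refine integral_eq_zero_of_ae (Filter.Eventually.of_forall fun x => ?_)
  simp only [Pi.zero_apply]
  rw [integral_const_mul, integral_const_mul]
  have h4 : ∀ t : ℝ, HasDerivAt (fun t : ℝ => φ (t, t • x)) (fderiv ℝ φ (t, t • x) (1, x)) t := by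
    intro t
    have hd : DifferentiableAt ℝ φ (t, t • x) := hφ.differentiable (by simp) _
    have h5 : HasDerivAt (fun t : ℝ => (t, t • x)) (1, x) t := by
      have := (hasDerivAt_id t).prodMk ((hasDerivAt_id t).smul_const x)
      simpa using this
    exact hd.hasFDerivAt.comp_hasDerivAt t h5
  have h5 : ∫ t in Set.Ioo (1 : ℝ) 2, fderiv ℝ φ (t, t • x) (1, x) = 0 := by
    rw [← integral_Ioc_eq_integral_Ioo, ← intervalIntegral.integral_of_le (by norm_num),
      intervalIntegral.integral_eq_sub_of_hasDerivAt (fun t _ => h4 t)]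
    · have e : ∀ t : ℝ, t ∉ Set.Ioo (1 : ℝ) 2 → φ (t, t • x) = 0 := fun t ht => by
        by_contra h
        exact ht (hs (subset_tsupport _ h)).1
      rw [e 2 (by simp), e 1 (by simp), sub_zero]
    · refine Continuous.intervalIntegrable ?_ _ _
      exact (hdφ.comp (by fun_prop)).clm_apply (by fun_prop)
  rw [h5]
  simp

/-- Flux part. -/
lemma ns_flux {d : ℕ} (m : ℝ → ℝ) (hm : ContinuousOn m (Set.Ioo 1 2))
    (e : EuclideanSpace ℝ (Fin d))
    (φ : ℝ × EuclideanSpace ℝ (Fin d) → ℝ) (hφ : ContDiff ℝ (⊤ : ℕ∞) φ)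
    (hcs : HasCompactSupport φ) (hs : tsupport φ ⊆ nsStrip d) :
    Integrable (fun p : ℝ × EuclideanSpace ℝ (Fin d) => m p.1 * fderiv ℝ φ p (0, e))
      (volume.restrict (nsStrip d)) ∧
    ∫ p in nsStrip d, m p.1 * fderiv ℝ φ p (0, e) = 0 := by
  have hdφ : Continuous (fderiv ℝ φ) := hφ.continuous_fderiv (by simp)
  have hint : Integrable (fun p : ℝ × EuclideanSpace ℝ (Fin d) => m p.1 * fderiv ℝ φ p (0, e))
      (volume.restrict (nsStrip d)) := by
    refine ns_integrable hcs hs ?_ ?_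
    · refine ContinuousOn.mul (hm.comp continuousOn_fst fun p hp => hp.1) ?_
      exact hdφ.continuousOn.clm_apply continuousOn_const
    · intro p hp
      rw [ns_fderiv_zero hp]
      simp
  refine ⟨hint, ?_⟩
  rw [nsStrip_measure] at hint ⊢
  rw [integral_prod _ hint]
  refine integral_eq_zero_of_ae (Filter.Eventually.of_forall fun t => ?_)
  simp only [Pi.zero_apply]
  rw [integral_const_mul]
  have hg : ContDiff ℝ (⊤ : ℕ∞) (fun y : EuclideanSpace ℝ (Fin d) => φ (t, y)) :=
    hφ.comp (contDiff_const.prodMk contDiff_id)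
  have hgc : HasCompactSupport (fun y : EuclideanSpace ℝ (Fin d) => φ (t, y)) := by
    refine HasCompactSupport.intro (hcs.isCompact.image continuous_snd) fun y hy => ?_
    by_contra h
    exact hy ⟨(t, y), subset_tsupport _ h, rfl⟩
  have h1 : ∀ y, fderiv ℝ φ (t, y) (0, e)
      = fderiv ℝ (fun y : EuclideanSpace ℝ (Fin d) => φ (t, y)) y e := by
    intro y
    have hd : DifferentiableAt ℝ φ (t, y) := hφ.differentiable (by simp) _
    have := hd.hasFDerivAt.comp y (hasFDerivAt_prodMk_right t y)
    have h2 := this.fderiv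
    simp only [Function.comp_def] at h2
    rw [h2]
    simp
  have hgi : Integrable (fun y => fderiv ℝ (fun y : EuclideanSpace ℝ (Fin d) => φ (t, y)) y e) :=
    Continuous.integrable_of_hasCompactSupport
      ((hg.continuous_fderiv (by simp)).clm_apply continuous_const) (hgc.fderiv_apply ℝ e)
  have h2 := integral_mul_fderiv_eq_neg_fderiv_mul_of_integrable (μ := volume)
    (f := fun _ : EuclideanSpace ℝ (Fin d) => (1 : ℝ))
    (g := fun y : EuclideanSpace ℝ (Fin d) => φ (t, y)) (v := e) (by simp) (by simpa using hgi)
    (by simpa using hg.continuous.integrable_of_hasCompactSupport hgc)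
    (fun _ _ => by fun_prop) (fun y _ => hg.differentiable (by simp) _)
  simp only [one_mul] at h2
  simp only [h1]
  rw [h2]
  simp

lemma ns_expand {d : ℕ} (L : ℝ × EuclideanSpace ℝ (Fin d) →L[ℝ] ℝ)
    (x : EuclideanSpace ℝ (Fin d)) :
    L (1, x) = L (1, 0) + ∑ j, x j * L (0, EuclideanSpace.single j 1) := by
  have hx : x = ∑ j, x j • EuclideanSpace.single j (1 : ℝ) := by
    have := (EuclideanSpace.basisFun (Fin d) ℝ).sum_repr x
    simpa using this.symm
  have h0 : L (0, x) = ∑ j, x j * L (0, EuclideanSpace.single j 1) := by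
    have : L (0, x) = (L.comp (ContinuousLinearMap.inr ℝ ℝ _)) x := by simp
    rw [this]
    conv_lhs => rw [hx]
    rw [map_sum]
    simp
  rw [← h0, ← map_add]
  simp

lemma ns_vel {d : ℕ} (s : ℝ) (y : EuclideanSpace ℝ (Fin d)) (i j : Fin d) :
    fderiv ℝ (fun y' : EuclideanSpace ℝ (Fin d) => y' i / s) y (EuclideanSpace.single j (1 : ℝ))
      = if i = j then s⁻¹ else 0 := by
  have : HasFDerivAt (fun y' : EuclideanSpace ℝ (Fin d) => y' i / s)
      (s⁻¹ • (EuclideanSpace.proj i : EuclideanSpace ℝ (Fin d) →L[ℝ] ℝ)) y := by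
    have := (EuclideanSpace.proj i : EuclideanSpace ℝ (Fin d) →L[ℝ] ℝ).hasFDerivAt (x := y)
    have h := this.const_smul s⁻¹
    refine h.congr_of_eventuallyEq (Filter.Eventually.of_forall fun z => ?_)
    simp [div_eq_inv_mul]
  rw [this.fderiv]
  simp

lemma ns_ae {d : ℕ} (hd : 1 ≤ d) (θ : ℝ) :
    ∀ᵐ p ∂((volume : Measure (ℝ × EuclideanSpace ℝ (Fin d))).restrict (nsStrip d)),
      p.1 ∈ Set.Ioo (1 : ℝ) 2 ∧
      Int.fract (‖p.2‖ / p.1) ≠ 0 ∧ Int.fract (‖p.2‖ / p.1) ≠ θ := by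
  have : Nonempty (Fin d) := ⟨⟨0, hd⟩⟩
  refine Filter.Eventually.and ?_ ?_
  · filter_upwards [ae_restrict_mem (nsStrip_open d).measurableSet] with p hp using hp.1
  rw [nsStrip_measure]
  have hmeas : Measurable (fun p : ℝ × EuclideanSpace ℝ (Fin d) => Int.fract (‖p.2‖ / p.1)) :=
    measurable_fract.comp (by fun_prop)
  rw [Measure.ae_prod_iff_ae_ae]
  · filter_upwards [ae_restrict_mem measurableSet_Ioo] with t ht
    have ht0 : 0 < t := by linarith [ht.1]
    have key : ∀ᵐ y : EuclideanSpace ℝ (Fin d), ∀ k : ℤ,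
        y ∉ Metric.sphere (0 : EuclideanSpace ℝ (Fin d)) (k * t) ∧
        y ∉ Metric.sphere (0 : EuclideanSpace ℝ (Fin d)) ((k + θ) * t) := by
      rw [ae_all_iff]
      intro k
      exact (measure_eq_zero_iff_ae_notMem.1 (Measure.addHaar_sphere _ _ _)).and
        (measure_eq_zero_iff_ae_notMem.1 (Measure.addHaar_sphere _ _ _))
    filter_upwards [key] with y hy
    have hh := hy ⌊‖y‖ / t⌋
    simp only [mem_sphere_zero_iff_norm] at hh
    have hf := Int.floor_add_fract (‖y‖ / t)
    constructor
    · intro h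
      apply hh.1
      rw [h, add_zero] at hf
      rw [hf]
      field_simp
    · intro h
      apply hh.2
      rw [h] at hf
      rw [hf]
      field_simp
  · exact (hmeas (measurableSet_singleton 0).compl).inter
      (hmeas (measurableSet_singleton θ).compl)

/-- The radially layered density `ρ = a/tᵈ` on the shells `kt < |y| < (k+θ)t` and
`ρ = b/tᵈ` on the shells `(k+θ)t < |y| < (k+1)t`, together with the smooth velocity
`u = y/t`, is a weak solution of the compressible Navier–Stokes system on `(1,2)×ℝᵈ`,
provided the (necessarily non-monotone) pressure satisfies `p(a/tᵈ) = p(b/tᵈ)` for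
`t ∈ [1,2]`. -/
theorem oscillating_weak_solution_compressible_navier_stokes
    {d : ℕ} (hd : 1 ≤ d) (θ : ℝ) (hθ : θ ∈ Set.Ioo (0 : ℝ) 1)
    (μ lam : ℝ) (a b : ℝ) (ha : 0 < a) (hab : a < b) (hab2 : a < b / 2 ^ d)
    (pr : ℝ → ℝ) (hpr : ContDiffOn ℝ 1 pr (Set.Ioi 0))
    (hpmatch : ∀ t ∈ Set.Icc (1 : ℝ) 2, pr (a / t ^ d) = pr (b / t ^ d))
    (rho : ℝ → EuclideanSpace ℝ (Fin d) → ℝ)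
    (hrho_a : ∀ t ∈ Set.Ioo (1 : ℝ) 2, ∀ y : EuclideanSpace ℝ (Fin d),
      (∃ k : ℕ, (k : ℝ) * t < ‖y‖ ∧ ‖y‖ < ((k : ℝ) + θ) * t) → rho t y = a / t ^ d)
    (hrho_b : ∀ t ∈ Set.Ioo (1 : ℝ) 2, ∀ y : EuclideanSpace ℝ (Fin d),
      (∃ k : ℕ, ((k : ℝ) + θ) * t < ‖y‖ ∧ ‖y‖ < ((k : ℝ) + 1) * t) → rho t y = b / t ^ d) :
    (∀ φ : ℝ × EuclideanSpace ℝ (Fin d) → ℝ, ContDiff ℝ (⊤ : ℕ∞) φ → HasCompactSupport φ →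
      tsupport φ ⊆ Set.Ioo (1 : ℝ) 2 ×ˢ (Set.univ : Set (EuclideanSpace ℝ (Fin d))) →
      (∫ p in Set.Ioo (1 : ℝ) 2 ×ˢ (Set.univ : Set (EuclideanSpace ℝ (Fin d))),
        (rho p.1 p.2 * fderiv ℝ φ p ((1 : ℝ), (0 : EuclideanSpace ℝ (Fin d)))
          + ∑ j, rho p.1 p.2 * (p.2 j / p.1) *
              fderiv ℝ φ p ((0 : ℝ), EuclideanSpace.single j (1 : ℝ)))) = 0) ∧
    (∀ ψ : ℝ × EuclideanSpace ℝ (Fin d) → EuclideanSpace ℝ (Fin d),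
      ContDiff ℝ (⊤ : ℕ∞) ψ → HasCompactSupport ψ →
      tsupport ψ ⊆ Set.Ioo (1 : ℝ) 2 ×ˢ (Set.univ : Set (EuclideanSpace ℝ (Fin d))) →
      (∫ p in Set.Ioo (1 : ℝ) 2 ×ˢ (Set.univ : Set (EuclideanSpace ℝ (Fin d))),
        ((∑ i, rho p.1 p.2 * (p.2 i / p.1) *
            fderiv ℝ (fun q => ψ q i) p ((1 : ℝ), (0 : EuclideanSpace ℝ (Fin d))))
         + (∑ i, ∑ j, rho p.1 p.2 * (p.2 i / p.1) * (p.2 j / p.1) *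
            fderiv ℝ (fun q => ψ q i) p ((0 : ℝ), EuclideanSpace.single j (1 : ℝ)))
         + pr (rho p.1 p.2) *
            (∑ i, fderiv ℝ (fun q => ψ q i) p ((0 : ℝ), EuclideanSpace.single i (1 : ℝ)))
         - μ * (∑ i, ∑ j,
            (fderiv ℝ (fun y' : EuclideanSpace ℝ (Fin d) => y' i / p.1) p.2
                (EuclideanSpace.single j (1 : ℝ))
              + fderiv ℝ (fun y' : EuclideanSpace ℝ (Fin d) => y' j / p.1) p.2
                (EuclideanSpace.single i (1 : ℝ))) *
            fderiv ℝ (fun q => ψ q i) p ((0 : ℝ), EuclideanSpace.single j (1 : ℝ)))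
         - lam * (∑ k, fderiv ℝ (fun y' : EuclideanSpace ℝ (Fin d) => y' k / p.1) p.2
                (EuclideanSpace.single k (1 : ℝ))) *
            (∑ i, fderiv ℝ (fun q => ψ q i) p
              ((0 : ℝ), EuclideanSpace.single i (1 : ℝ))))) = 0) := by
  obtain ⟨hθ0, hθ1⟩ := hθ
  have hb : 0 < b := ha.trans hab
  set c : EuclideanSpace ℝ (Fin d) → ℝ := fun x => if Int.fract ‖x‖ < θ then a else b with hcdef
  have hc : Measurable c :=
    Measurable.ite (measurableSet_lt (measurable_fract.comp measurable_norm) measurable_const)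
      measurable_const measurable_const
  have hC : ∀ x, ‖c x‖ ≤ b := by
    intro x
    simp only [hcdef]
    split_ifs
    · rw [Real.norm_eq_abs, abs_of_pos ha]
      exact hab.le
    · rw [Real.norm_eq_abs, abs_of_pos hb]
  have hae : ∀ᵐ p ∂((volume : Measure (ℝ × EuclideanSpace ℝ (Fin d))).restrict (nsStrip d)),
      p.1 ∈ Set.Ioo (1 : ℝ) 2 ∧ rho p.1 p.2 = c (p.1⁻¹ • p.2) / p.1 ^ d ∧
      pr (rho p.1 p.2) = pr (a / p.1 ^ d) := by
    filter_upwards [ns_ae hd θ] with p ⟨hp, hp0, hpθ⟩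
    have ht0 : 0 < p.1 := by linarith [hp.1]
    have hnorm : ‖p.1⁻¹ • p.2‖ = ‖p.2‖ / p.1 := by
      rw [norm_smul, Real.norm_eq_abs, abs_of_pos (inv_pos.2 ht0), div_eq_inv_mul]
    have hq0 : 0 ≤ ‖p.2‖ / p.1 := by positivity
    obtain ⟨k, hk⟩ := Int.eq_ofNat_of_zero_le (Int.floor_nonneg.2 hq0)
    have hf := Int.floor_add_fract (‖p.2‖ / p.1)
    rw [hk] at hf
    push_cast at hf
    have hy : ‖p.2‖ = ((k : ℝ) + Int.fract (‖p.2‖ / p.1)) * p.1 := by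
      rw [hf]
      field_simp
    have hpos : 0 < Int.fract (‖p.2‖ / p.1) := lt_of_le_of_ne (Int.fract_nonneg _) hp0.symm
    have hlt1 := Int.fract_lt_one (‖p.2‖ / p.1)
    refine ⟨hp, ?_⟩
    simp only [hcdef, hnorm]
    generalize Int.fract (‖p.2‖ / p.1) = r at *
    rcases lt_or_gt_of_ne hpθ with h | h
    · have e := hrho_a p.1 hp p.2 ⟨k, by rw [hy]; gcongr; linarith, by rw [hy]; gcongr⟩
      rw [if_pos h, e]
      exact ⟨rfl, rfl⟩
    · have e := hrho_b p.1 hp p.2 ⟨k, by rw [hy]; gcongr, by rw [hy]; gcongr⟩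
      rw [if_neg h.not_gt, e]
      exact ⟨rfl, (hpmatch p.1 ⟨hp.1.le, hp.2.le⟩).symm⟩
  refine ⟨fun φ hφ hcs hs => ?_, fun ψ hψ hcs hs => ?_⟩
  · refine Eq.trans ?_ (ns_transport c (fun _ => 1) hc b hC continuous_const φ hφ hcs hs).2
    refine integral_congr_ae ?_
    filter_upwards [hae] with p ⟨hp, h1, _⟩
    rw [ns_expand _ (p.1⁻¹ • p.2), h1, mul_add, mul_add, Finset.mul_sum, Finset.mul_sum]
    congr 1
    · ring
    · refine Finset.sum_congr rfl fun j _ => ?_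
      simp only [PiLp.smul_apply, smul_eq_mul]
      ring
  · have hψi : ∀ i, ContDiff ℝ (⊤ : ℕ∞) (fun q => ψ q i) := fun i =>
      (EuclideanSpace.proj i : EuclideanSpace ℝ (Fin d) →L[ℝ] ℝ).contDiff.comp hψ
    have hsub : ∀ i, tsupport (fun q => ψ q i) ⊆ tsupport ψ := fun i =>
      closure_mono fun q hq h => hq (by simp [h])
    have hcsi : ∀ i, HasCompactSupport (fun q => ψ q i) := fun i =>
      hcs.isCompact.of_isClosed_subset (isClosed_tsupport _) (hsub i)
    have hsi : ∀ i, tsupport (fun q => ψ q i) ⊆ nsStrip d := fun i => (hsub i).trans hs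
    have hm : ContinuousOn (fun t : ℝ => pr (a / t ^ d) - (2 * μ + lam * d) * t⁻¹)
        (Set.Ioo 1 2) := by
      have hne : ∀ t ∈ Set.Ioo (1 : ℝ) 2, 0 < t := fun t ht => by linarith [ht.1]
      refine ContinuousOn.sub (hpr.continuousOn.comp ?_ ?_) ?_
      · exact continuousOn_const.div (continuousOn_id.pow d)
          fun t ht => pow_ne_zero _ (hne t ht).ne'
      · intro t ht
        exact div_pos ha (pow_pos (hne t ht) d)
      · exact continuousOn_const.mul (continuousOn_id.inv₀ fun t ht => (hne t ht).ne')
    have hT := fun i => ns_transport c (fun x => x i) hc b hC (by fun_prop) _ (hψi i)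
      (hcsi i) (hsi i)
    have hF := fun i : Fin d => ns_flux _ hm (EuclideanSpace.single i (1 : ℝ)) _ (hψi i)
      (hcsi i) (hsi i)
    have hTi := integrable_finsetSum Finset.univ fun i _ => (hT i).1
    have hFi := integrable_finsetSum Finset.univ fun i _ => (hF i).1
    have hz := integral_add hTi hFi
    rw [integral_finsetSum _ fun i _ => (hT i).1, integral_finsetSum _ fun i _ => (hF i).1,
      Finset.sum_eq_zero fun i _ => (hT i).2, Finset.sum_eq_zero fun i _ => (hF i).2,
      add_zero] at hz
    refine Eq.trans ?_ hz
    refine integral_congr_ae ?_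
    filter_upwards [hae] with p ⟨hp, h1, h2⟩
    rw [h2, h1]
    simp only [ns_vel]
    have e1 : ∀ i, c (p.1⁻¹ • p.2) * ((p.1⁻¹ • p.2) i / p.1 ^ d *
        fderiv ℝ (fun q => ψ q i) p (1, p.1⁻¹ • p.2))
        = c (p.1⁻¹ • p.2) / p.1 ^ d * (p.2 i / p.1) * fderiv ℝ (fun q => ψ q i) p (1, 0)
          + ∑ j, c (p.1⁻¹ • p.2) / p.1 ^ d * (p.2 i / p.1) * (p.2 j / p.1) *
            fderiv ℝ (fun q => ψ q i) p (0, EuclideanSpace.single j (1 : ℝ)) := by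
      intro i
      rw [ns_expand _ (p.1⁻¹ • p.2), mul_add, mul_add, Finset.mul_sum, Finset.mul_sum]
      congr 1
      · simp only [PiLp.smul_apply, smul_eq_mul]
        ring
      · refine Finset.sum_congr rfl fun j _ => ?_
        simp only [PiLp.smul_apply, smul_eq_mul]
        ring
    have e2 : ∀ i, (∑ j, ((if i = j then p.1⁻¹ else 0) + (if j = i then p.1⁻¹ else 0)) *
        fderiv ℝ (fun q => ψ q i) p (0, EuclideanSpace.single j (1 : ℝ)))
        = 2 * p.1⁻¹ * fderiv ℝ (fun q => ψ q i) p (0, EuclideanSpace.single i (1 : ℝ)) := by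
      intro i
      rw [Finset.sum_eq_single i]
      · simp only [if_true]
        ring
      · intro j _ hj
        rw [if_neg hj.symm, if_neg hj]
        ring
      · simp
    simp only [e1, e2, Finset.sum_add_distrib, ← Finset.mul_sum, if_true, Finset.sum_const,
      Finset.card_univ, Fintype.card_fin, nsmul_eq_mul]
    ring
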